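/- arXiv:1701.03336 — 2 statements merged into one kernel-verified Lean document; each statement's English description precedes it below -/
import Mathlib

section
/- Let f be a bounded solution of the capillary problem on the sector Ω that is discontinuous at O, and assume the radial limit Rf(θ) exists for every θ ∈ (−α, α). Suppose f has an increasing lower fan: there exist α₁ ∈ [−α, α) and η > 0 such that Rf is constant on (−α, α₁] and strictly increasing on [α₁, α₁ + η] ∩ (−α, α); set β⁻ = α + α₁. Let m ∈ [−1, 1] and σ = arccos(m) ∈ [0, π]. If A⁻_S(b) ≥ m b for every b > 0 (with bε < δ* in the defining integrals), then β⁻ ≥ π − σ. -/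
open Real Set Filter MeasureTheory Topology

noncomputable section

/-- The open circular sector with vertex `O = (0,0)`, half-opening angle `α`, radius `δ`. -/
def sector (α δ : ℝ) : Set (ℝ × ℝ) :=
  {p | ∃ r θ : ℝ, 0 < r ∧ r < δ ∧ -α < θ ∧ θ < α ∧ p = (r * Real.cos θ, r * Real.sin θ)}

/-- The gradient of `f : ℝ × ℝ → ℝ`. -/
def grad (f : ℝ × ℝ → ℝ) (p : ℝ × ℝ) : ℝ × ℝ :=
  (fderiv ℝ f p (1, 0), fderiv ℝ f p (0, 1))

/-- `Tf = ∇f / √(1 + |∇f|²)`. -/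
def Tf (f : ℝ × ℝ → ℝ) (p : ℝ × ℝ) : ℝ × ℝ :=
  ((grad f p).1 / Real.sqrt (1 + (grad f p).1 ^ 2 + (grad f p).2 ^ 2),
   (grad f p).2 / Real.sqrt (1 + (grad f p).1 ^ 2 + (grad f p).2 ^ 2))

/-- `Nf = div (Tf)`. -/
def Nf (f : ℝ × ℝ → ℝ) (p : ℝ × ℝ) : ℝ :=
  fderiv ℝ (fun q => (Tf f q).1) p (1, 0) + fderiv ℝ (fun q => (Tf f q).2) p (0, 1)

/-- Euclidean dot product on `ℝ × ℝ`. -/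
def dot (v w : ℝ × ℝ) : ℝ := v.1 * w.1 + v.2 * w.2

/-- `f` is a bounded solution of the capillary problem `Nf = κ f + lam₀` in the sector,
`Tf ⬝ ν = cos γ` on the two open edges, with contact angles `γp, γm : (0,δ) → [0,π]`. -/
structure IsCapillarySolution (α δ κ lam₀ : ℝ) (γp γm : ℝ → ℝ) (f : ℝ × ℝ → ℝ) : Prop where
  measurable_γp : Measurable γp
  measurable_γm : Measurable γm
  range_γp : ∀ s ∈ Ioo (0:ℝ) δ, γp s ∈ Icc 0 π
  range_γm : ∀ s ∈ Ioo (0:ℝ) δ, γm s ∈ Icc 0 π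
  bounded : ∃ M : ℝ, ∀ p ∈ sector α δ, |f p| ≤ M
  smooth : ContDiffOn ℝ 2 f (sector α δ)
  pde : ∀ p ∈ sector α δ, Nf f p = κ * f p + lam₀
  edgeP_smooth : ∀ s ∈ Ioo (0:ℝ) δ, ContDiffAt ℝ 1 f (s * Real.cos α, s * Real.sin α)
  edgeM_smooth : ∀ s ∈ Ioo (0:ℝ) δ, ContDiffAt ℝ 1 f (s * Real.cos α, -(s * Real.sin α))
  bcP : ∀ s ∈ Ioo (0:ℝ) δ,
    dot (Tf f (s * Real.cos α, s * Real.sin α)) (-Real.sin α, Real.cos α) = Real.cos (γp s)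
  bcM : ∀ s ∈ Ioo (0:ℝ) δ,
    dot (Tf f (s * Real.cos α, -(s * Real.sin α))) (-Real.sin α, -Real.cos α) = Real.cos (γm s)

/-- `L` is the radial limit `Rf(θ)` of `f` in direction `θ`. -/
def RadialLimitAt (f : ℝ × ℝ → ℝ) (θ L : ℝ) : Prop :=
  Tendsto (fun r => f (r * Real.cos θ, r * Real.sin θ)) (𝓝[>] (0:ℝ)) (𝓝 L)

/-- `f` is discontinuous at the corner `O`: `f(x)` has no limit as `Ω ∋ x → O`. -/
def DiscontinuousAtCorner (α δ : ℝ) (f : ℝ × ℝ → ℝ) : Prop :=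
  ¬ ∃ L : ℝ, Tendsto f (𝓝[sector α δ] ((0:ℝ), (0:ℝ))) (𝓝 L)

/-- `A_I(b) = liminf_{ε→0⁺} (1/ε) ∫₀^{bε} cos γ(t) dt`. -/
def fanAI (γ : ℝ → ℝ) (b : ℝ) : ℝ :=
  liminf (fun ε : ℝ => ε⁻¹ * ∫ t in Ioo (0:ℝ) (b * ε), Real.cos (γ t)) (𝓝[>] (0:ℝ))

/-- `A_S(b) = limsup_{ε→0⁺} (1/ε) ∫₀^{bε} cos γ(t) dt`. -/
def fanAS (γ : ℝ → ℝ) (b : ℝ) : ℝ :=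
  limsup (fun ε : ℝ => ε⁻¹ * ∫ t in Ioo (0:ℝ) (b * ε), Real.cos (γ t)) (𝓝[>] (0:ℝ))


def Phi (φ : ℝ) (p : ℝ × ℝ) : ℝ × ℝ :=
  (p.1 * (Real.cos φ - p.2 * Real.sin φ), p.1 * (Real.sin φ + p.2 * Real.cos φ))

lemma Phi_cont (φ : ℝ) : Continuous (Phi φ) := by unfold Phi; fun_prop

lemma sector_open (α δ : ℝ) (hα : α ∈ Ioo 0 π) : IsOpen (sector α δ) := by
  have h := polarCoord.isOpen_image_symm_of_subset_target (t := Ioo 0 δ ×ˢ Ioo (-α) α)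
    (isOpen_Ioo.prod isOpen_Ioo) (by
      rintro ⟨r, t⟩ ⟨h1, h2⟩
      simp only [polarCoord_target, mem_prod, mem_Ioi, mem_Ioo] at *
      exact ⟨h1.1, by linarith [hα.2], by linarith [hα.2]⟩)
  convert h using 1
  ext p
  simp only [sector, mem_ofPred_eq, mem_image, Prod.exists, mem_prod, mem_Ioo, polarCoord_symm_apply]
  constructor
  · rintro ⟨r, t, h1, h2, h3, h4, rfl⟩
    exact ⟨r, t, ⟨⟨h1, h2⟩, h3, h4⟩, rfl⟩
  · rintro ⟨r, t, ⟨⟨h1, h2⟩, h3, h4⟩, rfl⟩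
    exact ⟨r, t, h1, h2, h3, h4, rfl⟩

lemma Phi_tan (φ ρ x : ℝ) (hx : Real.cos x ≠ 0) :
    Phi φ (ρ, Real.tan x) = (ρ / Real.cos x * Real.cos (φ + x), ρ / Real.cos x * Real.sin (φ + x)) := by
  simp only [Phi, Real.tan_eq_sin_div_cos, Real.cos_add, Real.sin_add]
  ext <;> field_simp

lemma Phi_deriv (φ : ℝ) (X : ℝ × ℝ → ℝ) (p : ℝ × ℝ) (hX : DifferentiableAt ℝ X (Phi φ p)) :
    HasDerivAt (fun x => X (Phi φ (x, p.2)))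
      ((Real.cos φ - p.2 * Real.sin φ) * fderiv ℝ X (Phi φ p) (1, 0)
        + (Real.sin φ + p.2 * Real.cos φ) * fderiv ℝ X (Phi φ p) (0, 1)) p.1 ∧
    HasDerivAt (fun y => X (Phi φ (p.1, y)))
      (p.1 * (-Real.sin φ) * fderiv ℝ X (Phi φ p) (1, 0)
        + p.1 * Real.cos φ * fderiv ℝ X (Phi φ p) (0, 1)) p.2 := by
  have key : ∀ u v : ℝ, fderiv ℝ X (Phi φ p) (u, v) =
      u * fderiv ℝ X (Phi φ p) (1, 0) + v * fderiv ℝ X (Phi φ p) (0, 1) := by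
    intro u v
    have : ((u, v) : ℝ × ℝ) = u • ((1 : ℝ), (0 : ℝ)) + v • ((0 : ℝ), (1 : ℝ)) := by simp
    rw [this, map_add, map_smul, map_smul]; simp
  constructor
  · rw [← key]
    have h1 : HasDerivAt (fun x : ℝ => Phi φ (x, p.2))
        (Real.cos φ - p.2 * Real.sin φ, Real.sin φ + p.2 * Real.cos φ) p.1 := by
      unfold Phi
      refine HasDerivAt.prodMk ?_ ?_
      · simpa using (hasDerivAt_id p.1).mul_const (Real.cos φ - p.2 * Real.sin φ)
      · simpa using (hasDerivAt_id p.1).mul_const (Real.sin φ + p.2 * Real.cos φ)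
    exact HasFDerivAt.comp_hasDerivAt (l := X) p.1 hX.hasFDerivAt h1
  · rw [← key]
    have h1 : HasDerivAt (fun y : ℝ => Phi φ (p.1, y))
        (p.1 * (-Real.sin φ), p.1 * Real.cos φ) p.2 := by
      unfold Phi
      refine HasDerivAt.prodMk ?_ ?_
      · simpa using (((hasDerivAt_id p.2).mul_const (Real.sin φ)).const_sub (Real.cos φ)).const_mul p.1
      · simpa using (((hasDerivAt_id p.2).mul_const (Real.cos φ)).const_add (Real.sin φ)).const_mul p.1
    exact HasFDerivAt.comp_hasDerivAt (l := X) p.2 hX.hasFDerivAt h1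

lemma div_lem (φ : ℝ) (X1 X2 D : ℝ × ℝ → ℝ) {a b c d : ℝ} (hab : a ≤ b) (hcd : c ≤ d)
    (hX1 : ∀ p ∈ Icc a b ×ˢ Icc c d, ContinuousAt X1 (Phi φ p))
    (hX2 : ∀ p ∈ Icc a b ×ˢ Icc c d, ContinuousAt X2 (Phi φ p))
    (hDc : ∀ p ∈ Icc a b ×ˢ Icc c d, ContinuousAt D (Phi φ p))
    (hd1 : ∀ p ∈ Ioo a b ×ˢ Ioo c d, DifferentiableAt ℝ X1 (Phi φ p))
    (hd2 : ∀ p ∈ Ioo a b ×ˢ Ioo c d, DifferentiableAt ℝ X2 (Phi φ p))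
    (hD : ∀ p ∈ Ioo a b ×ˢ Ioo c d,
      fderiv ℝ X1 (Phi φ p) (1, 0) + fderiv ℝ X2 (Phi φ p) (0, 1) = D (Phi φ p)) :
    ∫ x in a..b, ∫ y in c..d, x * D (Phi φ (x, y)) =
      (∫ x in a..b, ((Real.cos φ * X2 (Phi φ (x, d)) - Real.sin φ * X1 (Phi φ (x, d)))
          - d * (Real.cos φ * X1 (Phi φ (x, d)) + Real.sin φ * X2 (Phi φ (x, d)))))
      - (∫ x in a..b, ((Real.cos φ * X2 (Phi φ (x, c)) - Real.sin φ * X1 (Phi φ (x, c)))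
          - c * (Real.cos φ * X1 (Phi φ (x, c)) + Real.sin φ * X2 (Phi φ (x, c)))))
      + (∫ y in c..d, b * (Real.cos φ * X1 (Phi φ (b, y)) + Real.sin φ * X2 (Phi φ (b, y))))
      - ∫ y in c..d, a * (Real.cos φ * X1 (Phi φ (a, y)) + Real.sin φ * X2 (Phi φ (a, y))) := by
  classical
  set G1 : ℝ × ℝ → ℝ := fun p =>
    p.1 * (Real.cos φ * X1 (Phi φ p) + Real.sin φ * X2 (Phi φ p)) with hG1
  set G2 : ℝ × ℝ → ℝ := fun p =>
    (Real.cos φ * X2 (Phi φ p) - Real.sin φ * X1 (Phi φ p))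
          - p.2 * (Real.cos φ * X1 (Phi φ p) + Real.sin φ * X2 (Phi φ p)) with hG2
  have c1 : ContinuousOn (fun p => X1 (Phi φ p)) (Icc a b ×ˢ Icc c d) := fun p hp =>
    (ContinuousAt.comp (f := Phi φ) (hX1 p hp) (Phi_cont φ).continuousAt).continuousWithinAt
  have c2 : ContinuousOn (fun p => X2 (Phi φ p)) (Icc a b ×ˢ Icc c d) := fun p hp =>
    (ContinuousAt.comp (f := Phi φ) (hX2 p hp) (Phi_cont φ).continuousAt).continuousWithinAt
  have c3 : ContinuousOn (fun p => D (Phi φ p)) (Icc a b ×ˢ Icc c d) := fun p hp =>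
    (ContinuousAt.comp (f := Phi φ) (hDc p hp) (Phi_cont φ).continuousAt).continuousWithinAt
  have hPd : Differentiable ℝ (Phi φ) := by unfold Phi; fun_prop
  have e1 : ∀ p ∈ Ioo a b ×ˢ Ioo c d, DifferentiableAt ℝ (fun p => X1 (Phi φ p)) p := fun p hp =>
    DifferentiableAt.comp (f := Phi φ) p (hd1 p hp) (hPd p)
  have e2 : ∀ p ∈ Ioo a b ×ˢ Ioo c d, DifferentiableAt ℝ (fun p => X2 (Phi φ p)) p := fun p hp =>
    DifferentiableAt.comp (f := Phi φ) p (hd2 p hp) (hPd p)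
  have dG1 : ∀ p ∈ Ioo a b ×ˢ Ioo c d, DifferentiableAt ℝ G1 p := fun p hp => by
    have := e1 p hp
    have := e2 p hp
    fun_prop
  have dG2 : ∀ p ∈ Ioo a b ×ˢ Ioo c d, DifferentiableAt ℝ G2 p := fun p hp => by
    have := e1 p hp
    have := e2 p hp
    fun_prop
  have hdiv : ∀ p ∈ Ioo a b ×ˢ Ioo c d,
      fderiv ℝ G1 p (1, 0) + fderiv ℝ G2 p (0, 1) = p.1 * D (Phi φ p) := by
    intro p hp
    have a1 : HasDerivAt (fun x => G1 (x, p.2)) (fderiv ℝ G1 p (1, 0)) p.1 :=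
      HasFDerivAt.comp_hasDerivAt (l := G1) (f := fun x => (x, p.2)) p.1 (dG1 p hp).hasFDerivAt
        ((hasDerivAt_id p.1).prodMk (hasDerivAt_const _ _))
    have a2 : HasDerivAt (fun x => G2 (p.1, x)) (fderiv ℝ G2 p (0, 1)) p.2 :=
      HasFDerivAt.comp_hasDerivAt (l := G2) (f := fun x => (p.1, x)) p.2 (dG2 p hp).hasFDerivAt
        ((hasDerivAt_const _ _).prodMk (hasDerivAt_id p.2))
    obtain ⟨b1, b1'⟩ := Phi_deriv φ X1 p (hd1 p hp)
    obtain ⟨b2, b2'⟩ := Phi_deriv φ X2 p (hd2 p hp)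
    have u1 := a1.unique ((hasDerivAt_id p.1).mul ((b1.const_mul (Real.cos φ)).add (b2.const_mul (Real.sin φ))))
    have u2 := a2.unique (((b2'.const_mul (Real.cos φ)).sub (b1'.const_mul (Real.sin φ))).sub
      ((hasDerivAt_id p.2).mul ((b1'.const_mul (Real.cos φ)).add (b2'.const_mul (Real.sin φ)))))
    rw [u1, u2, ← hD p hp]
    have := Real.sin_sq_add_cos_sq φ
    simp only [id, Prod.mk.eta]
    linear_combination (p.1 * (fderiv ℝ X1 (Phi φ p) (1, 0) + fderiv ℝ X2 (Phi φ p) (0, 1))) * this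
  have kn : ContinuousOn (fun p => Real.cos φ * X1 (Phi φ p) + Real.sin φ * X2 (Phi φ p))
      (Icc a b ×ˢ Icc c d) := (continuousOn_const.mul c1).add (continuousOn_const.mul c2)
  have kt : ContinuousOn G2 (Icc a b ×ˢ Icc c d) :=
    ((continuousOn_const.mul c2).sub (continuousOn_const.mul c1)).sub (continuousOn_snd.mul kn)
  let B := Ioo a b ×ˢ Ioo c d
  let F' : ℝ × ℝ → ℝ × ℝ →L[ℝ] ℝ := fun p =>
    if p ∈ B then fderiv ℝ G1 p else (p.1 * D (Phi φ p)) • ContinuousLinearMap.fst ℝ ℝ ℝ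
  let F2' : ℝ × ℝ → ℝ × ℝ →L[ℝ] ℝ := fun p =>
    if p ∈ B then fderiv ℝ G2 p else 0
  have hF : ∀ p, F' p (1, 0) + F2' p (0, 1) = p.1 * D (Phi φ p) := by
    intro p
    by_cases hp : p ∈ B
    · simp only [F', F2', if_pos hp]; exact hdiv p hp
    · simp [F', F2', if_neg hp]
  have main := MeasureTheory.integral2_divergence_prod_of_hasFDerivAt_off_countable G1 G2 F' F2'
    a c b d ∅ countable_empty (by
      rw [uIcc_of_le hab, uIcc_of_le hcd]; exact continuousOn_fst.mul kn) (by
      rw [uIcc_of_le hab, uIcc_of_le hcd]; exact kt) (by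
      intro p hp
      simp only [min_eq_left hab, max_eq_right hab, min_eq_left hcd, max_eq_right hcd,
        sdiff_empty] at hp
      simp only [F']; rw [if_pos hp]; exact (dG1 p hp).hasFDerivAt) (by
      intro p hp
      simp only [min_eq_left hab, max_eq_right hab, min_eq_left hcd, max_eq_right hcd,
        sdiff_empty] at hp
      simp only [F2']; rw [if_pos hp]; exact (dG2 p hp).hasFDerivAt) (by
      simp only [hF]
      rw [uIcc_of_le hab, uIcc_of_le hcd]
      refine ContinuousOn.integrableOn_compact (isCompact_Icc.prod isCompact_Icc) ?_
      exact continuousOn_fst.mul c3)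
  simp only [hF] at main
  rw [main]

lemma Tf_facts (f : ℝ × ℝ → ℝ) (p : ℝ × ℝ) :
    (Tf f p).1 ^ 2 + (Tf f p).2 ^ 2 ≤ 1 := by
  have h0 : 0 < 1 + (grad f p).1 ^ 2 + (grad f p).2 ^ 2 := by positivity
  simp only [Tf, div_pow, Real.sq_sqrt h0.le]
  rw [← add_div, div_le_one h0]
  linarith

lemma dot_le (u v c d : ℝ) (h : u ^ 2 + v ^ 2 ≤ 1) (h' : c ^ 2 + d ^ 2 = 1) : |c * u + d * v| ≤ 1 := by
  rw [abs_le]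
  constructor <;> nlinarith [sq_nonneg (c - u), sq_nonneg (d - v), sq_nonneg (c + u), sq_nonneg (d + v)]

lemma Tf_grad (f : ℝ × ℝ → ℝ) (p : ℝ × ℝ) (c d : ℝ) (h' : c ^ 2 + d ^ 2 = 1) :
    -1 ≤ (grad f p).1 * ((Tf f p).1 - c) + (grad f p).2 * ((Tf f p).2 - d) := by
  set u := (grad f p).1 with hu
  set v := (grad f p).2 with hv
  have h0 : 0 < 1 + u ^ 2 + v ^ 2 := by positivity
  have hT1 : (Tf f p).1 = u / Real.sqrt (1 + u ^ 2 + v ^ 2) := rfl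
  have hT2 : (Tf f p).2 = v / Real.sqrt (1 + u ^ 2 + v ^ 2) := rfl
  rw [hT1, hT2]
  set W := Real.sqrt (1 + u ^ 2 + v ^ 2) with hW
  have hW2 : W ^ 2 = 1 + u ^ 2 + v ^ 2 := Real.sq_sqrt h0.le
  have hWp : 0 < W := Real.sqrt_pos.2 h0
  have hW1 : 1 ≤ W := by nlinarith [sq_nonneg u, sq_nonneg v]
  have h1 : c * u + d * v ≤ W := by
    apply le_of_sq_le_sq _ hWp.le
    nlinarith [sq_nonneg (c * v - d * u)]
  have h2 : u * (u / W) + v * (v / W) = W - 1 / W := by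
    field_simp
    linarith
  have h3 : 1 / W ≤ 1 := by rw [div_le_one hWp]; exact hW1
  nlinarith

lemma Tf_contAt (f : ℝ × ℝ → ℝ) (p : ℝ × ℝ) (h : ContDiffAt ℝ 1 f p) :
    ContinuousAt (fun q => (Tf f q).1) p ∧ ContinuousAt (fun q => (Tf f q).2) p ∧
    ContinuousAt (fun q => (grad f q).1) p ∧ ContinuousAt (fun q => (grad f q).2) p := by
  have h1 : ContinuousAt (fderiv ℝ f) p := (h.fderiv_right (m := 0) (by norm_num)).continuousAt
  have g1 : ContinuousAt (fun q => (grad f q).1) p := h1.clm_apply continuousAt_const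
  have g2 : ContinuousAt (fun q => (grad f q).2) p := h1.clm_apply continuousAt_const
  have hs : ContinuousAt (fun q => Real.sqrt (1 + (grad f q).1 ^ 2 + (grad f q).2 ^ 2)) p :=
    Real.continuous_sqrt.continuousAt.comp ((continuousAt_const.add (g1.pow 2)).add (g2.pow 2))
  have h0 : Real.sqrt (1 + (grad f p).1 ^ 2 + (grad f p).2 ^ 2) ≠ 0 := by positivity
  exact ⟨g1.div hs h0, g2.div hs h0, g1, g2⟩

lemma Tf_diffAt (f : ℝ × ℝ → ℝ) (p : ℝ × ℝ) (h : ContDiffAt ℝ 2 f p) :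
    DifferentiableAt ℝ (fun q => (Tf f q).1) p ∧ DifferentiableAt ℝ (fun q => (Tf f q).2) p := by
  have h1 : DifferentiableAt ℝ (fderiv ℝ f) p :=
    (h.fderiv_right (m := 1) (by norm_num)).differentiableAt (by norm_num)
  have g1 : DifferentiableAt ℝ (fun q => (grad f q).1) p := h1.clm_apply (differentiableAt_const _)
  have g2 : DifferentiableAt ℝ (fun q => (grad f q).2) p := h1.clm_apply (differentiableAt_const _)
  have h0 : (1 + (grad f p).1 ^ 2 + (grad f p).2 ^ 2) ≠ 0 := by positivity
  have hs : DifferentiableAt ℝ (fun q => Real.sqrt (1 + (grad f q).1 ^ 2 + (grad f q).2 ^ 2)) p :=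
    (((differentiableAt_const _).add (g1.pow 2)).add (g2.pow 2)).sqrt h0
  have h0 : Real.sqrt (1 + (grad f p).1 ^ 2 + (grad f p).2 ^ 2) ≠ 0 := by positivity
  simp only [Tf, div_eq_mul_inv]
  exact ⟨g1.fun_mul (hs.fun_inv h0), g2.fun_mul (hs.fun_inv h0)⟩

lemma int_lower (g : ℝ → ℝ) {a b c : ℝ} (hab : a ≤ b) (hc : 0 ≤ c)
    (h : ∀ x ∈ Icc a b, -c ≤ g x) : -c * (b - a) ≤ ∫ x in a..b, g x := by
  by_cases hg : IntervalIntegrable g volume a b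
  · have := intervalIntegral.integral_mono_on hab (f := fun _ => -c) (by simp) hg h
    simp at this
    linarith
  · rw [intervalIntegral.integral_undef hg]
    nlinarith

lemma mem_sec {α δ : ℝ} {φ ρ τ : ℝ} (hρ : 0 < ρ) (h2 : ρ * Real.sqrt (1 + τ ^ 2) < δ)
    (h3 : -α < φ + Real.arctan τ) (h4 : φ + Real.arctan τ < α) : Phi φ (ρ, τ) ∈ sector α δ := by
  have hc := Real.cos_arctan_pos τ
  refine ⟨ρ / Real.cos (Real.arctan τ), φ + Real.arctan τ, by positivity, ?_, h3, h4, ?_⟩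
  · rw [Real.cos_arctan]; simpa using h2
  · rw [← Phi_tan φ ρ _ hc.ne', Real.tan_arctan]

lemma radial_Phi {f : ℝ × ℝ → ℝ} {φ τ L : ℝ} (h : RadialLimitAt f (φ + Real.arctan τ) L) :
    Tendsto (fun ρ => f (Phi φ (ρ, τ))) (𝓝[>] (0:ℝ)) (𝓝 L) := by
  have hc := Real.cos_arctan_pos τ
  have : (fun ρ => f (Phi φ (ρ, τ))) =
      (fun r => f (r * Real.cos (φ + Real.arctan τ), r * Real.sin (φ + Real.arctan τ))) ∘
        (fun ρ => (Real.cos (Real.arctan τ))⁻¹ * ρ) := by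
    ext ρ
    simp only [Function.comp]
    conv_lhs => rw [← Real.tan_arctan τ, Phi_tan φ ρ _ hc.ne']
    rw [div_eq_inv_mul]
  rw [this]
  refine Tendsto.comp h ?_
  refine tendsto_nhdsWithin_iff.2 ⟨?_, ?_⟩
  · have : Tendsto (fun ρ : ℝ => (Real.cos (Real.arctan τ))⁻¹ * ρ) (𝓝 0) (𝓝 ((Real.cos (Real.arctan τ))⁻¹ * 0)) :=
      tendsto_id.const_mul _
    rw [mul_zero] at this
    exact this.mono_left nhdsWithin_le_nhds
  · filter_upwards [self_mem_nhdsWithin] with x hx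
    have : 0 < x := hx
    simp only [mem_Ioi]; positivity

set_option maxHeartbeats 2000000 in
lemma ray_flux {α δ κ lam₀ : ℝ} {γp γm : ℝ → ℝ} {f : ℝ × ℝ → ℝ} {R : ℝ → ℝ}
    (hα : α ∈ Ioo 0 π) (hδ : 0 < δ)
    (hsol : IsCapillarySolution α δ κ lam₀ γp γm f)
    (hR : ∀ θ ∈ Ioo (-α) α, RadialLimitAt f θ (R θ))
    {θ1 θ2 : ℝ} (h1 : -α < θ1) (h12 : θ1 < θ2) (h2 : θ2 < α) (hd : θ2 - θ1 < π / 2)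
    (hmono : StrictMonoOn R (Icc θ1 θ2)) {a : ℝ} (ha : a ∈ Ioo (0:ℝ) 1) :
    ∀ᶠ ε in 𝓝[>] (0:ℝ), (1 - a) * ε - 12 * Real.tan (θ2 - θ1) * ε ≤
      ∫ s in a * ε..ε, (Real.cos θ2 * (Tf f (Phi θ2 (s, 0))).2 - Real.sin θ2 * (Tf f (Phi θ2 (s, 0))).1) := by
  obtain ⟨ha0, ha1⟩ := ha
  obtain ⟨M, hM⟩ := hsol.bounded
  set t := Real.tan (θ2 - θ1) with ht
  have ht0 : 0 < t := Real.tan_pos_of_pos_of_lt_pi_div_two (by linarith) hd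
  have hat : Real.arctan t = θ2 - θ1 := Real.arctan_tan (by linarith [Real.pi_pos]) hd
  set k := R θ1 with hk
  set Δ := R θ2 - R θ1 with hΔ
  have hΔ0 : 0 < Δ := sub_pos.2 (hmono (left_mem_Icc.2 h12.le) (right_mem_Icc.2 h12.le) h12)
  have hang : ∀ τ ∈ Icc (-t) 0, θ2 + Real.arctan τ ∈ Icc θ1 θ2 := by
    intro τ hτ
    have e1 := Real.arctan_mono hτ.1
    have e2 := Real.arctan_mono hτ.2
    rw [Real.arctan_neg, hat] at e1
    rw [Real.arctan_zero] at e2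
    exact ⟨by linarith, by linarith⟩
  set S := Real.sqrt (1 + t ^ 2) with hS
  have hS0 : 0 < S := Real.sqrt_pos.2 (by positivity)
  have hsec : ∀ ρ τ, 0 < ρ → ρ * S < δ → τ ∈ Icc (-t) 0 → Phi θ2 (ρ, τ) ∈ sector α δ := by
    intro ρ τ hρ hρ2 hτ
    have := hang τ hτ
    refine mem_sec hρ (lt_of_le_of_lt ?_ hρ2) (by linarith [this.1]) (by linarith [this.2])
    refine mul_le_mul_of_nonneg_left (Real.sqrt_le_sqrt ?_) hρ.le
    nlinarith [hτ.1, hτ.2]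
  have hopen := sector_open α δ hα
  have hC2 : ∀ p ∈ sector α δ, ContDiffAt ℝ 2 f p := fun p hp =>
    hsol.smooth.contDiffAt (hopen.mem_nhds hp)
  have hC1 : ∀ p ∈ sector α δ, ContDiffAt ℝ 1 f p := fun p hp =>
    (hC2 p hp).of_le (by norm_num)
  set Hm := |κ| * M + |lam₀| with hHm
  set K := M + |k| with hK
  have hfk : ∀ p ∈ sector α δ, |f p - k| ≤ K := fun p hp =>
    (abs_sub _ _).trans (by linarith [hM p hp])
  have hH : ∀ p ∈ sector α δ, |κ * f p + lam₀| ≤ Hm := fun p hp => by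
    refine (abs_add_le _ _).trans ?_
    rw [abs_mul]
    have := mul_le_mul_of_nonneg_left (hM p hp) (abs_nonneg κ)
    linarith
  -- small radius for everything
  set ω := t * Δ / (2 + t) with hω
  have hω0 : 0 < ω := by positivity
  have ev1 : ∀ᶠ ρ in 𝓝[>] (0:ℝ), Δ / 2 < f (Phi θ2 (ρ, 0)) - k := by
    have : Tendsto (fun ρ => f (Phi θ2 (ρ, 0)) - k) (𝓝[>] (0:ℝ)) (𝓝 (R θ2 - k)) :=
      (radial_Phi (by simpa using hR θ2 ⟨by linarith, h2⟩)).sub_const k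
    exact this.eventually (lt_mem_nhds (by linarith))
  have ev2 : ∀ᶠ ρ in 𝓝[>] (0:ℝ), |f (Phi θ2 (ρ, -t)) - k| < ω := by
    have : Tendsto (fun ρ => |f (Phi θ2 (ρ, -t)) - k|) (𝓝[>] (0:ℝ)) (𝓝 |R θ1 - k|) := by
      refine ((radial_Phi ?_).sub_const k).abs
      rw [Real.arctan_neg, hat]
      have := hR θ1 ⟨h1, by linarith⟩
      convert this using 1; ring
    refine this.eventually (gt_mem_nhds ?_)
    simpa [hk] using hω0
  have ev3 : ∀ᶠ ρ in 𝓝[>] (0:ℝ), ρ * S < δ := by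
    have : Tendsto (fun ρ : ℝ => ρ * S) (𝓝 0) (𝓝 (0 * S)) := tendsto_id.mul_const S
    rw [zero_mul] at this
    exact (this.mono_left nhdsWithin_le_nhds).eventually (gt_mem_nhds hδ)
  have hcontf : ∀ ρ, 0 < ρ → ρ * S < δ → ContinuousOn (fun τ => f (Phi θ2 (ρ, τ))) (Icc (-t) 0) := by
    intro ρ hρ hρ2 τ hτ
    have c := (hC1 _ (hsec ρ τ hρ hρ2 hτ)).continuousAt
    exact (ContinuousAt.comp (f := fun τ => Phi θ2 (ρ, τ)) c
      ((Phi_cont θ2).comp (Continuous.prodMk_right ρ)).continuousAt).continuousWithinAt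
  have ev4 : ∀ᶠ ρ in 𝓝[>] (0:ℝ), ∫ τ in (-t)..0, max |f (Phi θ2 (ρ, τ)) - k| Δ < 2 * t * Δ := by
    have : Tendsto (fun ρ => ∫ τ in (-t)..0, max |f (Phi θ2 (ρ, τ)) - k| Δ) (𝓝[>] (0:ℝ))
        (𝓝 (∫ τ in (-t)..0, Δ)) := by
      refine intervalIntegral.tendsto_integral_filter_of_dominated_convergence (fun _ => max K Δ) ?_ ?_
        (by simp) ?_
      · filter_upwards [ev3, self_mem_nhdsWithin] with ρ hρ hρ0
        rw [uIoc_of_le (by linarith)]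
        refine ContinuousOn.aestronglyMeasurable ?_ measurableSet_Ioc
        exact ((((hcontf ρ hρ0 hρ).mono Ioc_subset_Icc_self).sub continuousOn_const).abs).sup continuousOn_const
      · filter_upwards [ev3, self_mem_nhdsWithin] with ρ hρ hρ0
        refine Eventually.of_forall fun τ hτ => ?_
        rw [uIoc_of_le (by linarith)] at hτ
        rw [Real.norm_eq_abs, abs_of_nonneg (le_max_of_le_left (abs_nonneg _))]
        exact max_le_max (hfk _ (hsec ρ τ hρ0 hρ (Ioc_subset_Icc_self hτ))) le_rfl
      · refine Eventually.of_forall fun τ hτ => ?_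
        rw [uIoc_of_le (by linarith)] at hτ
        have hh := hang τ (Ioc_subset_Icc_self hτ)
        have := ((radial_Phi (hR (θ2 + Real.arctan τ) ⟨by linarith [hh.1], by linarith [hh.2]⟩)).sub_const k).abs.max
          (tendsto_const_nhds (x := Δ))
        convert this using 2
        rw [eq_comm, max_eq_right]
        have g1 := hmono.monotoneOn (left_mem_Icc.2 h12.le) hh hh.1
        have g2 := hmono.monotoneOn hh (right_mem_Icc.2 h12.le) hh.2
        rw [abs_of_nonneg (by linarith)]
        linarith
    refine this.eventually (gt_mem_nhds ?_)
    simp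
    nlinarith
  have ev5 : ∀ᶠ ρ in 𝓝[>] (0:ℝ), ρ * (1 + K * Hm) < Δ := by
    have : Tendsto (fun ρ : ℝ => ρ * (1 + K * Hm)) (𝓝 0) (𝓝 (0 * (1 + K * Hm))) := tendsto_id.mul_const _
    rw [zero_mul] at this
    exact (this.mono_left nhdsWithin_le_nhds).eventually (gt_mem_nhds hΔ0)
  obtain ⟨r0, hr0, hall⟩ := mem_nhdsGT_iff_exists_Ioo_subset.1 (ev1.and (ev2.and (ev3.and (ev4.and ev5))))
  have hr0' : Ioo 0 r0 ∈ 𝓝[>] (0:ℝ) := Ioo_mem_nhdsGT hr0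
  filter_upwards [hr0'] with ε hε
  obtain ⟨-, -, hεS, hεq, hεC⟩ := hall hε
  have hε0 := hε.1
  have haε0 : 0 < a * ε := by positivity
  have haε : a * ε < ε := by nlinarith
  obtain ⟨-, -, haεS, haεq, -⟩ := hall (show a * ε ∈ Ioo 0 r0 from ⟨haε0, by linarith [hε.2]⟩)
  have hall' : ∀ ρ ∈ Icc (a * ε) ε, Δ / 2 < f (Phi θ2 (ρ, 0)) - k ∧ |f (Phi θ2 (ρ, -t)) - k| < ω ∧ ρ * S < δ := by
    intro ρ hρ
    have := hall (show ρ ∈ Ioo 0 r0 from ⟨by linarith [hρ.1], by linarith [hρ.2, hε.2]⟩)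
    exact ⟨this.1, this.2.1, this.2.2.1⟩
  have hbox : ∀ p ∈ Icc (a * ε) ε ×ˢ Icc (-t) 0, Phi θ2 p ∈ sector α δ := by
    rintro ⟨ρ, τ⟩ ⟨q1, q2⟩
    exact hsec ρ τ (by linarith [q1.1]) (hall' ρ q1).2.2 q2
  have hbox' : ∀ p ∈ Ioo (a * ε) ε ×ˢ Ioo (-t) 0, Phi θ2 p ∈ sector α δ := fun p hp =>
    hbox p ⟨Ioo_subset_Icc_self hp.1, Ioo_subset_Icc_self hp.2⟩
  have hcs := Real.sin_sq_add_cos_sq θ2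
  have main := div_lem θ2 (fun q => (f q - k) * ((Tf f q).1 + Real.sin θ2))
    (fun q => (f q - k) * ((Tf f q).2 - Real.cos θ2))
    (fun q => (grad f q).1 * ((Tf f q).1 + Real.sin θ2) + (grad f q).2 * ((Tf f q).2 - Real.cos θ2)
      + (f q - k) * (κ * f q + lam₀)) (a := a * ε) (b := ε) (c := -t) (d := 0) haε.le (by linarith)
    (fun p hp => by
      have c0 := (hC1 _ (hbox p hp)).continuousAt
      obtain ⟨c1, c2, c3, c4⟩ := Tf_contAt f _ (hC1 _ (hbox p hp))
      exact (c0.sub continuousAt_const).mul (c1.add continuousAt_const))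
    (fun p hp => by
      have c0 := (hC1 _ (hbox p hp)).continuousAt
      obtain ⟨c1, c2, c3, c4⟩ := Tf_contAt f _ (hC1 _ (hbox p hp))
      exact (c0.sub continuousAt_const).mul (c2.sub continuousAt_const))
    (fun p hp => by
      have c0 := (hC1 _ (hbox p hp)).continuousAt
      obtain ⟨c1, c2, c3, c4⟩ := Tf_contAt f _ (hC1 _ (hbox p hp))
      exact ((c3.mul (c1.add continuousAt_const)).add (c4.mul (c2.sub continuousAt_const))).add
        ((c0.sub continuousAt_const).mul ((continuousAt_const.mul c0).add continuousAt_const)))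
    (fun p hp => by
      have c0 := (hC1 _ (hbox' p hp)).differentiableAt (by norm_num)
      obtain ⟨c1, c2⟩ := Tf_diffAt f _ (hC2 _ (hbox' p hp))
      exact (c0.sub_const _).fun_mul (c1.add_const _))
    (fun p hp => by
      have c0 := (hC1 _ (hbox' p hp)).differentiableAt (by norm_num)
      obtain ⟨c1, c2⟩ := Tf_diffAt f _ (hC2 _ (hbox' p hp))
      exact (c0.sub_const _).fun_mul (c2.sub_const _))
    (fun p hp => by
      have c0 := (hC1 _ (hbox' p hp)).differentiableAt (by norm_num)
      obtain ⟨c1, c2⟩ := Tf_diffAt f _ (hC2 _ (hbox' p hp))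
      have e1 := ((c0.hasFDerivAt.sub_const k).fun_mul (c1.hasFDerivAt.add_const (Real.sin θ2))).fderiv
      have e2 := ((c0.hasFDerivAt.sub_const k).fun_mul (c2.hasFDerivAt.sub_const (Real.cos θ2))).fderiv
      rw [e1, e2, ← hsol.pde _ (hbox' p hp)]
      simp [Nf, grad]
      ring)
  have L0 : -(ε * (1 + K * Hm) * t) * (ε - a * ε) ≤ ∫ x in a * ε..ε, ∫ y in (-t)..0, x *
      ((grad f (Phi θ2 (x, y))).1 * ((Tf f (Phi θ2 (x, y))).1 + Real.sin θ2)
      + (grad f (Phi θ2 (x, y))).2 * ((Tf f (Phi θ2 (x, y))).2 - Real.cos θ2)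
      + (f (Phi θ2 (x, y)) - k) * (κ * f (Phi θ2 (x, y)) + lam₀)) := by
    have hp0 : Phi θ2 (ε, 0) ∈ sector α δ := hbox (ε, 0) ⟨⟨haε.le, le_rfl⟩, ⟨by linarith, le_rfl⟩⟩
    have hK0 : 0 ≤ K := (abs_nonneg _).trans (hfk _ hp0)
    have hH0 : 0 ≤ Hm := (abs_nonneg _).trans (hH _ hp0)
    refine int_lower _ haε.le (by positivity) fun x hx => ?_
    have hx0 : 0 < x := by linarith [hx.1]
    refine le_trans ?_ (int_lower _ (c := ε * (1 + K * Hm)) (by linarith) (by positivity) fun y hy => ?_)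
    · apply le_of_eq; ring
    · have hp := hbox (x, y) ⟨hx, hy⟩
      have q1 := Tf_grad f (Phi θ2 (x, y)) (-Real.sin θ2) (Real.cos θ2) (by linarith)
      have q2 : |(f (Phi θ2 (x, y)) - k) * (κ * f (Phi θ2 (x, y)) + lam₀)| ≤ K * Hm := by
        rw [abs_mul]; exact mul_le_mul (hfk _ hp) (hH _ hp) (abs_nonneg _) hK0
      have q3 := (abs_le.1 q2).1
      have q4 : x * (1 + K * Hm) ≤ ε * (1 + K * Hm) := mul_le_mul_of_nonneg_right hx.2 (by positivity)
      rw [sub_neg_eq_add] at q1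
      nlinarith [mul_le_mul_of_nonneg_left (add_le_add q1 q3) hx0.le]
  rw [main] at L0
  clear main
  have hTn : ∀ p, |Real.cos θ2 * (Tf f p).1 + Real.sin θ2 * (Tf f p).2| ≤ 1 := fun p =>
    dot_le _ _ _ _ (Tf_facts f p) (by linarith)
  have hTt : ∀ p, |-Real.sin θ2 * (Tf f p).1 + Real.cos θ2 * (Tf f p).2| ≤ 1 := fun p =>
    dot_le _ _ _ _ (Tf_facts f p) (by linarith)
  have hgn : ∀ p, Real.cos θ2 * ((f p - k) * ((Tf f p).1 + Real.sin θ2)) +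
      Real.sin θ2 * ((f p - k) * ((Tf f p).2 - Real.cos θ2)) =
      (f p - k) * (Real.cos θ2 * (Tf f p).1 + Real.sin θ2 * (Tf f p).2) := fun p => by ring
  have hgt : ∀ p, Real.cos θ2 * ((f p - k) * ((Tf f p).2 - Real.cos θ2)) -
      Real.sin θ2 * ((f p - k) * ((Tf f p).1 + Real.sin θ2)) =
      (f p - k) * (-Real.sin θ2 * (Tf f p).1 + Real.cos θ2 * (Tf f p).2 - 1) := fun p => by
    linear_combination (-(f p - k)) * hcs
  simp only [hgn, hgt] at L0
  have side : ∀ b, 0 < b → b * S < δ → ∫ τ in (-t)..0, max |f (Phi θ2 (b, τ)) - k| Δ < 2 * t * Δ →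
      |∫ y in (-t)..0, b * ((f (Phi θ2 (b, y)) - k) *
        (Real.cos θ2 * (Tf f (Phi θ2 (b, y))).1 + Real.sin θ2 * (Tf f (Phi θ2 (b, y))).2))| ≤ b * (2 * t * Δ) := by
    intro b hb hbS hbq
    have : |∫ y in (-t)..0, b * ((f (Phi θ2 (b, y)) - k) *
        (Real.cos θ2 * (Tf f (Phi θ2 (b, y))).1 + Real.sin θ2 * (Tf f (Phi θ2 (b, y))).2))| ≤
        ∫ y in (-t)..0, b * max |f (Phi θ2 (b, y)) - k| Δ := by
      rw [← Real.norm_eq_abs]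
      refine intervalIntegral.norm_integral_le_of_norm_le (by linarith) (Eventually.of_forall fun y hy => ?_) ?_
      · rw [Real.norm_eq_abs, abs_mul, abs_of_pos hb, abs_mul]
        refine mul_le_mul_of_nonneg_left ?_ hb.le
        refine le_trans ?_ (le_max_left _ _)
        exact mul_le_of_le_one_right (abs_nonneg _) (hTn _)
      · refine ContinuousOn.intervalIntegrable ?_
        rw [uIcc_of_le (by linarith)]
        exact continuousOn_const.mul ((((hcontf b hb hbS)).sub continuousOn_const).abs.sup continuousOn_const)
    refine this.trans ?_
    rw [intervalIntegral.integral_const_mul]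
    exact mul_le_mul_of_nonneg_left hbq.le hb.le
  have s1 := abs_le.1 (side ε hε0 hεS hεq)
  have s2 := abs_le.1 (side (a * ε) haε0 haεS haεq)
  have s3 : |∫ x in a * ε..ε, ((f (Phi θ2 (x, -t)) - k) * (-Real.sin θ2 * (Tf f (Phi θ2 (x, -t))).1 +
      Real.cos θ2 * (Tf f (Phi θ2 (x, -t))).2 - 1) - -t * ((f (Phi θ2 (x, -t)) - k) *
      (Real.cos θ2 * (Tf f (Phi θ2 (x, -t))).1 + Real.sin θ2 * (Tf f (Phi θ2 (x, -t))).2)))| ≤ t * Δ * ε := by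
    have := intervalIntegral.norm_integral_le_of_norm_le_const (a := a * ε) (b := ε) (C := t * Δ)
      (f := fun x => (f (Phi θ2 (x, -t)) - k) * (-Real.sin θ2 * (Tf f (Phi θ2 (x, -t))).1 +
      Real.cos θ2 * (Tf f (Phi θ2 (x, -t))).2 - 1) - -t * ((f (Phi θ2 (x, -t)) - k) *
      (Real.cos θ2 * (Tf f (Phi θ2 (x, -t))).1 + Real.sin θ2 * (Tf f (Phi θ2 (x, -t))).2))) (by
        intro x hx
        rw [uIoc_of_le haε.le] at hx
        have w1 := (hall' x (Ioc_subset_Icc_self hx)).2.1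
        set P := Phi θ2 (x, -t)
        have w2 := abs_le.1 (hTn P)
        have w3 := abs_le.1 (hTt P)
        set u := Real.cos θ2 * (Tf f P).1 + Real.sin θ2 * (Tf f P).2
        set v := -Real.sin θ2 * (Tf f P).1 + Real.cos θ2 * (Tf f P).2
        have : (f P - k) * (v - 1) - -t * ((f P - k) * u) = (f P - k) * (v - 1 + t * u) := by ring
        rw [this, Real.norm_eq_abs, abs_mul]
        have w4 : |v - 1 + t * u| ≤ 2 + t := by
          have w6 := mul_le_mul_of_nonneg_left w2.1 ht0.le
          have w7 := mul_le_mul_of_nonneg_left w2.2 ht0.le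
          rw [abs_le]; constructor <;> linarith [w3.1, w3.2]
        have w5 : ω * (2 + t) = t * Δ := by rw [hω]; field_simp
        rw [← w5]
        exact mul_le_mul w1.le w4 (abs_nonneg _) hω0.le)
    rw [Real.norm_eq_abs, abs_of_pos (by linarith : 0 < ε - a * ε)] at this
    refine this.trans (mul_le_mul_of_nonneg_left (by linarith) (by positivity))
  have s3 := abs_le.1 s3
  have hcE : ContinuousOn (fun x => -Real.sin θ2 * (Tf f (Phi θ2 (x, 0))).1 +
      Real.cos θ2 * (Tf f (Phi θ2 (x, 0))).2) (uIcc (a * ε) ε) := by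
    rw [uIcc_of_le haε.le]
    intro x hx
    obtain ⟨c1, c2, -, -⟩ := Tf_contAt f _ (hC1 _ (hbox (x, 0) ⟨hx, by constructor <;> linarith⟩))
    have cP : ContinuousAt (fun x : ℝ => Phi θ2 (x, 0)) x :=
      ((Phi_cont θ2).comp (Continuous.prodMk_left 0)).continuousAt
    exact ((continuousAt_const.mul (ContinuousAt.comp (f := fun x : ℝ => Phi θ2 (x, 0)) c1 cP)).add
      (continuousAt_const.mul (ContinuousAt.comp (f := fun x : ℝ => Phi θ2 (x, 0)) c2 cP))).continuousWithinAt
  have hcf : ContinuousOn (fun x => f (Phi θ2 (x, 0))) (uIcc (a * ε) ε) := by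
    rw [uIcc_of_le haε.le]
    intro x hx
    have c1 := (hC1 _ (hbox (x, 0) ⟨hx, by constructor <;> linarith⟩)).continuousAt
    have cP : ContinuousAt (fun x : ℝ => Phi θ2 (x, 0)) x :=
      ((Phi_cont θ2).comp (Continuous.prodMk_left 0)).continuousAt
    exact (ContinuousAt.comp (f := fun x : ℝ => Phi θ2 (x, 0)) c1 cP).continuousWithinAt
  have s4 : ∫ x in a * ε..ε, ((f (Phi θ2 (x, 0)) - k) * (-Real.sin θ2 * (Tf f (Phi θ2 (x, 0))).1 +
      Real.cos θ2 * (Tf f (Phi θ2 (x, 0))).2 - 1) - 0 * ((f (Phi θ2 (x, 0)) - k) *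
      (Real.cos θ2 * (Tf f (Phi θ2 (x, 0))).1 + Real.sin θ2 * (Tf f (Phi θ2 (x, 0))).2)))
      ≤ Δ / 2 * ((∫ x in a * ε..ε, (-Real.sin θ2 * (Tf f (Phi θ2 (x, 0))).1 +
      Real.cos θ2 * (Tf f (Phi θ2 (x, 0))).2)) - (ε - a * ε)) := by
    have e : (∫ x in a * ε..ε, (-Real.sin θ2 * (Tf f (Phi θ2 (x, 0))).1 +
      Real.cos θ2 * (Tf f (Phi θ2 (x, 0))).2)) - (ε - a * ε) = ∫ x in a * ε..ε, ((-Real.sin θ2 * (Tf f (Phi θ2 (x, 0))).1 +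
      Real.cos θ2 * (Tf f (Phi θ2 (x, 0))).2) - 1) := by
      rw [intervalIntegral.integral_sub hcE.intervalIntegrable (by simp)]
      simp
    rw [e, ← intervalIntegral.integral_const_mul]
    simp only [zero_mul, sub_zero]
    refine intervalIntegral.integral_mono_on haε.le ?_ ?_ fun x hx => ?_
    · exact ((hcf.sub continuousOn_const).mul (hcE.sub continuousOn_const)).intervalIntegrable
    · exact (continuousOn_const.mul (hcE.sub continuousOn_const)).intervalIntegrable
    · have w1 := (hall' x hx).1
      have w3 := abs_le.1 (hTt (Phi θ2 (x, 0)))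
      nlinarith
  have e : ∀ s, Real.cos θ2 * (Tf f (Phi θ2 (s, 0))).2 - Real.sin θ2 * (Tf f (Phi θ2 (s, 0))).1 =
    -Real.sin θ2 * (Tf f (Phi θ2 (s, 0))).1 + Real.cos θ2 * (Tf f (Phi θ2 (s, 0))).2 := fun s => by ring
  simp only [e]
  set I := ∫ x in a * ε..ε, (-Real.sin θ2 * (Tf f (Phi θ2 (x, 0))).1 +
      Real.cos θ2 * (Tf f (Phi θ2 (x, 0))).2)
  have f1 : ε * (1 + K * Hm) * t * (ε - a * ε) ≤ Δ * t * ε := by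
    have : 0 < t * (ε - a * ε) := mul_pos ht0 (by linarith)
    have r1 := mul_le_mul_of_nonneg_right hεC.le this.le
    have r2 : Δ * (t * (ε - a * ε)) ≤ Δ * (t * ε) :=
      mul_le_mul_of_nonneg_left (mul_le_mul_of_nonneg_left (by linarith) ht0.le) hΔ0.le
    linarith
  have f2 : a * ε * (2 * t * Δ) ≤ ε * (2 * t * Δ) := mul_le_mul_of_nonneg_right haε.le (by positivity)
  have f3 : 0 ≤ Δ * (I - (ε - a * ε) + 12 * t * ε) := by
    nlinarith [L0, s1.1, s1.2, s2.1, s2.2, s3.1, s3.2, s4]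
  have f4 := nonneg_of_mul_nonneg_right f3 hΔ0
  linarith

lemma tri_flux {α δ κ lam₀ : ℝ} {γp γm : ℝ → ℝ} {f : ℝ × ℝ → ℝ}
    (hα : α ∈ Ioo 0 π) (hδ : 0 < δ)
    (hsol : IsCapillarySolution α δ κ lam₀ γp γm f)
    {φ A ψ : ℝ} (hA : A ∈ Ioo (-(π / 2)) (π / 2)) (hψ : ψ ∈ Ioo (-(π / 2)) (π / 2))
    (hφA : φ - A = -α) (hφψ : φ + ψ < α) (hAψ : 0 < A + ψ) {a : ℝ} (ha : a ∈ Ioo (0:ℝ) 1) :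
    ∃ C : ℝ, ∀ᶠ ε in 𝓝[>] (0:ℝ),
      (∫ s in (a * ε / Real.cos A)..(ε / Real.cos A), Real.cos (γm s)) +
      (∫ s in (a * ε / Real.cos ψ)..(ε / Real.cos ψ),
        (Real.cos (φ + ψ) * (Tf f (Phi (φ + ψ) (s, 0))).2 - Real.sin (φ + ψ) * (Tf f (Phi (φ + ψ) (s, 0))).1))
      ≤ (1 + a) * ε * (Real.tan ψ + Real.tan A) + C * ε ^ 2 := by
  obtain ⟨ha0, ha1⟩ := ha
  obtain ⟨M, hM⟩ := hsol.bounded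
  have hcA : 0 < Real.cos A := Real.cos_pos_of_mem_Ioo hA
  have hcψ : 0 < Real.cos ψ := Real.cos_pos_of_mem_Ioo hψ
  set tA := Real.tan A with htA
  set tψ := Real.tan ψ with htψ
  have hatA : Real.arctan tA = A := Real.arctan_tan hA.1 hA.2
  have hatψ : Real.arctan tψ = ψ := Real.arctan_tan hψ.1 hψ.2
  have htt : -tA < tψ := by
    rw [← Real.arctan_strictMono.lt_iff_lt, Real.arctan_neg, hatA, hatψ]; linarith
  set S := Real.sqrt (1 + tA ^ 2 + tψ ^ 2) with hS
  have hopen := sector_open α δ hα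
  have hC2 : ∀ p ∈ sector α δ, ContDiffAt ℝ 2 f p := fun p hp =>
    hsol.smooth.contDiffAt (hopen.mem_nhds hp)
  set Hm := |κ| * M + |lam₀| with hHm
  have hH : ∀ p ∈ sector α δ, |κ * f p + lam₀| ≤ Hm := fun p hp => by
    refine (abs_add_le _ _).trans ?_
    rw [abs_mul]
    have := mul_le_mul_of_nonneg_left (hM p hp) (abs_nonneg κ)
    linarith
  have hsec : ∀ ρ τ, 0 < ρ → ρ * S < δ → τ ∈ Ioc (-tA) tψ → Phi φ (ρ, τ) ∈ sector α δ := by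
    intro ρ τ hρ hρ2 hτ
    have e1 := Real.arctan_strictMono hτ.1
    have e2 := Real.arctan_mono hτ.2
    rw [Real.arctan_neg, hatA] at e1
    rw [hatψ] at e2
    refine mem_sec hρ (lt_of_le_of_lt ?_ hρ2) (by linarith) (by linarith)
    refine mul_le_mul_of_nonneg_left (Real.sqrt_le_sqrt ?_) hρ.le
    have : τ ^ 2 ≤ tA ^ 2 + tψ ^ 2 := by
      rcases le_total 0 τ with h | h
      · nlinarith [hτ.2, sq_nonneg tA]
      · nlinarith [hτ.1, sq_nonneg tψ]
    linarith
  have ev3 : ∀ᶠ ρ in 𝓝[>] (0:ℝ), ρ * S < δ := by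
    have : Tendsto (fun ρ : ℝ => ρ * S) (𝓝 0) (𝓝 (0 * S)) := tendsto_id.mul_const S
    rw [zero_mul] at this
    exact (this.mono_left nhdsWithin_le_nhds).eventually (gt_mem_nhds hδ)
  have ev4 : ∀ᶠ ρ in 𝓝[>] (0:ℝ), ρ / Real.cos A < δ := by
    have : Tendsto (fun ρ : ℝ => ρ / Real.cos A) (𝓝 0) (𝓝 (0 / Real.cos A)) := tendsto_id.div_const _
    rw [zero_div] at this
    exact (this.mono_left nhdsWithin_le_nhds).eventually (gt_mem_nhds hδ)
  have hedge : ∀ ρ, Phi φ (ρ, -tA) = (ρ / Real.cos A * Real.cos α, -(ρ / Real.cos A * Real.sin α)) := by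
    intro ρ
    have := Phi_tan φ ρ (-A) (by rw [Real.cos_neg]; exact hcA.ne')
    rw [Real.tan_neg, Real.cos_neg, ← sub_eq_add_neg, hφA, Real.cos_neg, Real.sin_neg, mul_neg] at this
    exact this
  have hup : ∀ ρ, Phi φ (ρ, tψ) = Phi (φ + ψ) (ρ / Real.cos ψ, 0) := by
    intro ρ
    rw [htψ, Phi_tan φ ρ ψ hcψ.ne']
    simp [Phi]
  refine ⟨Hm * (tψ + tA), ?_⟩
  filter_upwards [ev3, ev4, self_mem_nhdsWithin] with ε hεS hεA hε0
  replace hε0 : 0 < ε := hε0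
  have haε0 : 0 < a * ε := by positivity
  have haε : a * ε < ε := by nlinarith
  have hS0 : 0 ≤ S := Real.sqrt_nonneg _
  have hbox1 : ∀ x y, x ∈ Icc (a * ε) ε → y ∈ Ioc (-tA) tψ → Phi φ (x, y) ∈ sector α δ := fun x y hx hy =>
    hsec x y (by linarith [hx.1]) (lt_of_le_of_lt (mul_le_mul_of_nonneg_right hx.2 hS0) hεS) hy
  have hs : ∀ x ∈ Icc (a * ε) ε, x / Real.cos A ∈ Ioo 0 δ := fun x hx => by
    have : 0 < x := by linarith [hx.1]
    exact ⟨by positivity, lt_of_le_of_lt (div_le_div_of_nonneg_right hx.2 hcA.le) hεA⟩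
  have hC1 : ∀ p ∈ Icc (a * ε) ε ×ˢ Icc (-tA) tψ, ContDiffAt ℝ 1 f (Phi φ p) := by
    rintro ⟨x, y⟩ ⟨hx, hy⟩
    dsimp only at hx hy
    rcases eq_or_lt_of_le hy.1 with h | h
    · rw [← h, hedge]
      exact hsol.edgeM_smooth _ (hs x hx)
    · exact (hC2 _ (hbox1 x y hx ⟨h, hy.2⟩)).of_le (by norm_num)
  have hbox' : ∀ p ∈ Ioo (a * ε) ε ×ˢ Ioo (-tA) tψ, Phi φ p ∈ sector α δ := fun p hp =>
    hbox1 p.1 p.2 (Ioo_subset_Icc_self hp.1) (Ioo_subset_Ioc_self hp.2)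
  have main := div_lem φ (fun q => (Tf f q).1) (fun q => (Tf f q).2)
    (fun q => κ * f q + lam₀) (a := a * ε) (b := ε) (c := -tA) (d := tψ) haε.le htt.le
    (fun p hp => (Tf_contAt f _ (hC1 p hp)).1)
    (fun p hp => (Tf_contAt f _ (hC1 p hp)).2.1)
    (fun p hp => (continuousAt_const.mul (hC1 p hp).continuousAt).add continuousAt_const)
    (fun p hp => (Tf_diffAt f _ (hC2 _ (hbox' p hp))).1)
    (fun p hp => (Tf_diffAt f _ (hC2 _ (hbox' p hp))).2)
    (fun p hp => by rw [← hsol.pde _ (hbox' p hp)]; rfl)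
  have hcs := Real.sin_sq_add_cos_sq φ
  have hTn : ∀ p, |Real.cos φ * (Tf f p).1 + Real.sin φ * (Tf f p).2| ≤ 1 := fun p =>
    dot_le _ _ _ _ (Tf_facts f p) (by linarith)
  have hH0 : 0 ≤ Hm := (abs_nonneg _).trans (hH _ (hbox1 ε tψ ⟨haε.le, le_rfl⟩ ⟨htt, le_rfl⟩))
  have htt' : 0 < tψ - -tA := by linarith
  have b0 : |∫ x in a * ε..ε, ∫ y in (-tA)..tψ, x * (κ * f (Phi φ (x, y)) + lam₀)| ≤
      Hm * (tψ + tA) * ε ^ 2 := by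
    have := intervalIntegral.norm_integral_le_of_norm_le_const (a := a * ε) (b := ε)
      (C := ε * Hm * (tψ + tA)) (f := fun x => ∫ y in (-tA)..tψ, x * (κ * f (Phi φ (x, y)) + lam₀)) (by
      intro x hx
      rw [uIoc_of_le haε.le] at hx
      have hx0 : 0 < x := by linarith [hx.1]
      have := intervalIntegral.norm_integral_le_of_norm_le_const (a := -tA) (b := tψ)
        (C := ε * Hm) (f := fun y => x * (κ * f (Phi φ (x, y)) + lam₀)) (by
        intro y hy
        rw [uIoc_of_le htt.le] at hy
        rw [Real.norm_eq_abs, abs_mul, abs_of_pos hx0]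
        exact mul_le_mul hx.2 (hH _ (hbox1 x y (Ioc_subset_Icc_self hx) hy)) (abs_nonneg _) hε0.le)
      rwa [abs_of_pos htt', sub_neg_eq_add] at this)
    rw [Real.norm_eq_abs, abs_of_pos (by linarith : 0 < ε - a * ε)] at this
    refine this.trans ?_
    have r : 0 ≤ ε * Hm * (tψ + tA) := by
      have : 0 ≤ tψ + tA := by linarith
      positivity
    nlinarith [mul_le_mul_of_nonneg_left (by linarith : ε - a * ε ≤ ε) r]
  have side : ∀ b, 0 < b → |∫ y in (-tA)..tψ, b * (Real.cos φ * (Tf f (Phi φ (b, y))).1 +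
      Real.sin φ * (Tf f (Phi φ (b, y))).2)| ≤ b * (tψ + tA) := by
    intro b hb
    have := intervalIntegral.norm_integral_le_of_norm_le_const (a := -tA) (b := tψ)
        (C := b) (f := fun y => b * (Real.cos φ * (Tf f (Phi φ (b, y))).1 +
      Real.sin φ * (Tf f (Phi φ (b, y))).2)) (by
        intro y hy
        rw [Real.norm_eq_abs, abs_mul, abs_of_pos hb]
        exact mul_le_of_le_one_right hb.le (hTn _))
    rwa [abs_of_pos htt', sub_neg_eq_add] at this
  have i1 : (∫ x in a * ε..ε, (Real.cos φ * (Tf f (Phi φ (x, tψ))).2 - Real.sin φ * (Tf f (Phi φ (x, tψ))).1 -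
      tψ * (Real.cos φ * (Tf f (Phi φ (x, tψ))).1 + Real.sin φ * (Tf f (Phi φ (x, tψ))).2))) =
      ∫ s in (a * ε / Real.cos ψ)..(ε / Real.cos ψ),
        (Real.cos (φ + ψ) * (Tf f (Phi (φ + ψ) (s, 0))).2 - Real.sin (φ + ψ) * (Tf f (Phi (φ + ψ) (s, 0))).1) := by
    have h := intervalIntegral.integral_comp_div (a := a * ε) (b := ε) (c := Real.cos ψ)
      (fun s => (Real.cos (φ + ψ) * (Tf f (Phi (φ + ψ) (s, 0))).2 - Real.sin (φ + ψ) * (Tf f (Phi (φ + ψ) (s, 0))).1))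
      hcψ.ne'
    rw [smul_eq_mul] at h
    apply mul_left_cancel₀ hcψ.ne'
    rw [← h, ← intervalIntegral.integral_const_mul]
    congr 1
    ext x
    rw [hup, htψ, Real.tan_eq_sin_div_cos, Real.cos_add, Real.sin_add]
    field_simp
    ring
  have i2 : (∫ x in a * ε..ε, (Real.cos φ * (Tf f (Phi φ (x, -tA))).2 - Real.sin φ * (Tf f (Phi φ (x, -tA))).1 -
      -tA * (Real.cos φ * (Tf f (Phi φ (x, -tA))).1 + Real.sin φ * (Tf f (Phi φ (x, -tA))).2))) =
      - ∫ s in (a * ε / Real.cos A)..(ε / Real.cos A), Real.cos (γm s) := by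
    have h := intervalIntegral.integral_comp_div (a := a * ε) (b := ε) (c := Real.cos A)
      (fun s => Real.cos (γm s)) hcA.ne'
    rw [smul_eq_mul] at h
    apply mul_left_cancel₀ hcA.ne'
    rw [mul_neg, ← h, ← intervalIntegral.integral_const_mul, ← intervalIntegral.integral_neg]
    refine intervalIntegral.integral_congr fun x hx => ?_
    rw [uIcc_of_le haε.le] at hx
    have hb := hsol.bcM _ (hs x hx)
    simp only [dot] at hb
    rw [← hb, hedge]
    have q1 : Real.cos α = Real.cos φ * Real.cos A + Real.sin φ * Real.sin A := by
      rw [← Real.cos_sub, hφA, Real.cos_neg]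
    have q2 : Real.sin α = -(Real.sin φ * Real.cos A - Real.cos φ * Real.sin A) := by
      rw [← Real.sin_sub, hφA, Real.sin_neg, neg_neg]
    set P := (x / Real.cos A * Real.cos α, -(x / Real.cos A * Real.sin α))
    rw [q1, q2, htA, Real.tan_eq_sin_div_cos]
    field_simp
    ring
  rw [i1, i2] at main
  have s1 := abs_le.1 (side ε hε0)
  have s2 := abs_le.1 (side (a * ε) haε0)
  have s0 := abs_le.1 b0
  linarith [s1.1, s2.2, s0.2]

lemma fan_step {α δ κ lam₀ : ℝ} {γp γm : ℝ → ℝ} {f : ℝ × ℝ → ℝ} {R : ℝ → ℝ}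
    (hα : α ∈ Ioo 0 π) (hδ : 0 < δ)
    (hsol : IsCapillarySolution α δ κ lam₀ γp γm f)
    (hR : ∀ θ ∈ Ioo (-α) α, RadialLimitAt f θ (R θ))
    {α₁ η : ℝ} (hα₁ : α₁ ∈ Ico (-α) α)
    (hmono : StrictMonoOn R (Icc α₁ (α₁ + η) ∩ Ioo (-α) α))
    {m : ℝ} (hAS : ∀ b : ℝ, 0 < b → m * b ≤ fanAS γm b)
    {θ2 ψ : ℝ} (k1 : α₁ < θ2) (k2 : θ2 < α₁ + η) (k3 : θ2 < α) (_k4 : θ2 < π - α)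
    (p1 : α + θ2 - π / 2 < ψ) (p0 : 0 < ψ) (p2 : ψ < π / 2) :
    m ≤ Real.sin (α + θ2 - ψ) + Real.cos (α + θ2 - ψ) * (Real.tan ψ - 1 / Real.cos ψ) := by
  have hα₁' := hα₁.1
  set A := α + θ2 - ψ with hAdef
  have hA : A ∈ Ioo (-(π / 2)) (π / 2) := ⟨by linarith, by linarith⟩
  have hψ : ψ ∈ Ioo (-(π / 2)) (π / 2) := ⟨by linarith, p2⟩
  have hcA : 0 < Real.cos A := Real.cos_pos_of_mem_Ioo hA
  have hcψ : 0 < Real.cos ψ := Real.cos_pos_of_mem_Ioo hψ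
  have key : ∀ a ∈ Ioo (0:ℝ) 1, m ≤ a + Real.cos A * ((1 + a) * (Real.tan ψ + Real.tan A)
      - (1 - a - a) / Real.cos ψ) + a := by
    intro a ha
    obtain ⟨θ1, t1, t2, t3, t4⟩ : ∃ θ1, α₁ < θ1 ∧ θ1 < θ2 ∧ θ2 - θ1 < π / 2 ∧
        12 * Real.tan (θ2 - θ1) ≤ a := by
      have hlim : Tendsto (fun θ1 => 12 * Real.tan (θ2 - θ1)) (𝓝[<] θ2) (𝓝 (12 * Real.tan (θ2 - θ2))) := by
        refine Tendsto.mono_left ?_ nhdsWithin_le_nhds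
        have h1 : ContinuousAt Real.tan (θ2 - θ2) := Real.continuousAt_tan.2 (by simp)
        have h2 : ContinuousAt (fun θ1 => θ2 - θ1) θ2 := by fun_prop
        exact continuousAt_const.mul (ContinuousAt.comp (f := fun θ1 => θ2 - θ1) h1 h2)
      rw [sub_self, Real.tan_zero, mul_zero] at hlim
      have ev := hlim.eventually (gt_mem_nhds ha.1)
      have hmem : Ioo (max α₁ (θ2 - π / 2)) θ2 ∈ 𝓝[<] θ2 :=
        Ioo_mem_nhdsLT (max_lt k1 (by linarith [Real.pi_pos]))
      obtain ⟨θ1, e1, e2⟩ := (ev.and hmem).exists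
      obtain ⟨q1, q2⟩ := max_lt_iff.1 e2.1
      exact ⟨θ1, q1, e2.2, by linarith, e1.le⟩
    have hray := ray_flux hα hδ hsol hR (by linarith : -α < θ1) t2 k3 t3
      (hmono.mono fun x hx => ⟨⟨by linarith [hx.1], by linarith [hx.2]⟩, by linarith [hx.1], by linarith [hx.2]⟩) ha
    obtain ⟨C, hC⟩ := tri_flux hα hδ hsol (φ := θ2 - ψ) hA hψ (by rw [hAdef]; ring) (by linarith)
      (by linarith) ha
    rw [sub_add_cancel] at hC
    obtain ⟨ha0, ha1⟩ := ha
    have hscale : ∀ c : ℝ, 0 < c → Tendsto (fun e : ℝ => c * e) (𝓝[>] 0) (𝓝[>] 0) := by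
      intro c hc
      refine tendsto_nhdsWithin_iff.2 ⟨?_, ?_⟩
      · have : Tendsto (fun ρ : ℝ => c * ρ) (𝓝 0) (𝓝 (c * 0)) := tendsto_id.const_mul _
        rw [mul_zero] at this
        exact this.mono_left nhdsWithin_le_nhds
      · filter_upwards [self_mem_nhdsWithin] with x hx
        have : 0 < x := hx
        simp only [mem_Ioi]; positivity
    have hC' := (hscale _ hcA).eventually hC
    have hray' := (hscale (Real.cos A / Real.cos ψ) (by positivity)).eventually hray
    have ev5 : ∀ᶠ e in 𝓝[>] (0:ℝ), e * (C * Real.cos A ^ 2) < a := by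
      have : Tendsto (fun ρ : ℝ => ρ * (C * Real.cos A ^ 2)) (𝓝 0) (𝓝 (0 * (C * Real.cos A ^ 2))) :=
        tendsto_id.mul_const _
      rw [zero_mul] at this
      exact (this.mono_left nhdsWithin_le_nhds).eventually (gt_mem_nhds ha0)
    have hmeas : Measurable fun t => Real.cos (γm t) := Real.measurable_cos.comp hsol.measurable_γm
    have hint : ∀ x y, IntervalIntegrable (fun t => Real.cos (γm t)) volume x y := by
      intro x y
      refine (intervalIntegrable_const (c := (1:ℝ))).mono_fun hmeas.aestronglyMeasurable ?_
      exact Eventually.of_forall fun t => by simpa using Real.abs_cos_le_one _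
    have hbd : ∀ x, 0 ≤ x → |∫ t in (0:ℝ)..x, Real.cos (γm t)| ≤ x := by
      intro x hx
      have := intervalIntegral.norm_integral_le_of_norm_le_const (a := 0) (b := x) (C := 1)
        (f := fun t => Real.cos (γm t)) (fun t _ => Real.abs_cos_le_one _)
      simpa [abs_of_nonneg hx] using this
    have hconv : ∀ e, 0 < e → ∫ t in Ioo (0:ℝ) (1 * e), Real.cos (γm t) = ∫ t in (0:ℝ)..e, Real.cos (γm t) := by
      intro e he
      rw [one_mul, intervalIntegral.integral_of_le he.le, integral_Ioc_eq_integral_Ioo]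
    have h1 := hAS 1 one_pos
    rw [mul_one] at h1
    refine h1.trans ?_
    unfold fanAS
    refine Filter.limsup_le_of_le ?_ ?_
    · refine IsBoundedUnder.isCoboundedUnder_le ⟨-1, ?_⟩
      rw [eventually_map]
      filter_upwards [self_mem_nhdsWithin] with e he
      replace he : 0 < e := he
      rw [hconv e he]
      have := (abs_le.1 (hbd e he.le)).1
      have h2 := mul_le_mul_of_nonneg_left this (inv_nonneg.2 he.le)
      rw [mul_neg, inv_mul_cancel₀ he.ne'] at h2
      exact h2
    · filter_upwards [hC', hray', ev5, self_mem_nhdsWithin] with e u1 u2 u3 he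
      replace he : 0 < e := he
      rw [hconv e he]
      have s1 : a * (Real.cos A * e) / Real.cos A = a * e := by field_simp
      have s2 : Real.cos A * e / Real.cos A = e := by field_simp
      have s3 : a * (Real.cos A * e) / Real.cos ψ = a * (Real.cos A / Real.cos ψ * e) := by ring
      have s4 : Real.cos A * e / Real.cos ψ = Real.cos A / Real.cos ψ * e := by ring
      rw [s1, s2, s3, s4] at u1
      have hsplit := intervalIntegral.integral_add_adjacent_intervals (hint 0 (a * e)) (hint (a * e) e)
      have b1 := (abs_le.1 (hbd (a * e) (by positivity))).2
      have hq : 0 < Real.cos A / Real.cos ψ * e := by positivity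
      have u4 := mul_le_mul_of_nonneg_right t4 hq.le
      have u5 := mul_le_mul_of_nonneg_left u3.le he.le
      rw [inv_mul_le_iff₀ he, ← hsplit]
      have e1 : e * (a + Real.cos A * ((1 + a) * (Real.tan ψ + Real.tan A)
          - (1 - a - a) / Real.cos ψ) + a) = a * e + (1 + a) * (Real.cos A * e) * (Real.tan ψ + Real.tan A)
          - (1 - a - a) * (Real.cos A / Real.cos ψ * e) + e * a := by ring
      rw [e1]
      nlinarith [u1, u2, u4, u5, b1]
  have hlim : Tendsto (fun a : ℝ => a + Real.cos A * ((1 + a) * (Real.tan ψ + Real.tan A)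
      - (1 - a - a) / Real.cos ψ) + a) (𝓝[>] 0) (𝓝 (0 + Real.cos A * ((1 + 0) * (Real.tan ψ + Real.tan A)
      - (1 - 0 - 0) / Real.cos ψ) + 0)) := by
    refine Tendsto.mono_left ?_ nhdsWithin_le_nhds
    exact (by fun_prop : Continuous (fun a : ℝ => a + Real.cos A * ((1 + a) * (Real.tan ψ + Real.tan A)
      - (1 - a - a) / Real.cos ψ) + a)).continuousAt
  have := ge_of_tendsto hlim (by
    filter_upwards [Ioo_mem_nhdsGT one_pos] with a ha using key a ha)
  refine this.trans (le_of_eq ?_)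
  have e : Real.cos A * Real.tan A = Real.sin A := by
    rw [mul_comm]; exact Real.tan_mul_cos hcA.ne'
  rw [← e]; ring

/-- (Corollary, part (c).) If `f` has an increasing lower fan of size
`β⁻ = α + α₁` and `A⁻_S(b) ≥ m b` for every `b > 0`, where `m ∈ [−1,1]` and
`σ = arccos m`, then `β⁻ ≥ π − σ`. -/
theorem lower_fan_size_lower_bound
    (α δ κ lam₀ : ℝ) (γp γm : ℝ → ℝ) (f : ℝ × ℝ → ℝ) (R : ℝ → ℝ)
    (hα : α ∈ Ioo 0 π) (hδ : 0 < δ)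
    (hsol : IsCapillarySolution α δ κ lam₀ γp γm f)
    (hdisc : DiscontinuousAtCorner α δ f)
    (hR : ∀ θ ∈ Ioo (-α) α, RadialLimitAt f θ (R θ))
    (α₁ η : ℝ) (hα₁ : α₁ ∈ Ico (-α) α) (hη : 0 < η)
    (hconst : ∃ c : ℝ, ∀ θ ∈ Ioc (-α) α₁, R θ = c)
    (hmono : StrictMonoOn R (Icc α₁ (α₁ + η) ∩ Ioo (-α) α))
    (m : ℝ) (hm : m ∈ Icc (-1 : ℝ) 1)
    (hAS : ∀ b : ℝ, 0 < b → m * b ≤ fanAS γm b) :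
    π - Real.arccos m ≤ α + α₁ := by
  obtain ⟨hm1, hm2⟩ := hm
  rcases le_or_gt π (α + α₁) with hβ | hβ
  · linarith [Real.arccos_nonneg m]
  have key : ∀ θ2, α₁ < θ2 → θ2 < α₁ + η → θ2 < α → θ2 < π - α → m ≤ -Real.cos (α + θ2) := by
    intro θ2 k1 k2 k3 k4
    have step : ∀ ψ, α + θ2 - π / 2 < ψ → 0 < ψ → ψ < π / 2 →
        m ≤ Real.sin (α + θ2 - ψ) + Real.cos (α + θ2 - ψ) * (Real.tan ψ - 1 / Real.cos ψ) := by
      intro ψ p1 p0 p2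
      exact fan_step hα hδ hsol hR hα₁ hmono hAS k1 k2 k3 k4 p1 p0 p2
    have hpos : 0 < 1 + Real.sin (π / 2) := by rw [Real.sin_pi_div_two]; norm_num
    have hlim : Tendsto (fun ψ => Real.sin (α + θ2 - ψ) -
        Real.cos (α + θ2 - ψ) * (Real.cos ψ / (1 + Real.sin ψ))) (𝓝[<] (π / 2))
        (𝓝 (Real.sin (α + θ2 - π / 2) -
        Real.cos (α + θ2 - π / 2) * (Real.cos (π / 2) / (1 + Real.sin (π / 2))))) := by
      refine Tendsto.mono_left ?_ nhdsWithin_le_nhds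
      have : ContinuousAt (fun ψ => Real.sin (α + θ2 - ψ) -
        Real.cos (α + θ2 - ψ) * (Real.cos ψ / (1 + Real.sin ψ))) (π / 2) := by
        have hne := hpos.ne'
        fun_prop (disch := exact hne)
      exact this
    rw [Real.sin_sub_pi_div_two, Real.cos_pi_div_two, zero_div, mul_zero, sub_zero] at hlim
    refine ge_of_tendsto hlim ?_
    have hmem : Ioo (max (α + θ2 - π / 2) 0) (π / 2) ∈ 𝓝[<] (π / 2) :=
      Ioo_mem_nhdsLT (max_lt (by linarith) (by linarith [Real.pi_pos]))
    filter_upwards [hmem] with ψ hψ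
    have p0 : 0 < ψ := lt_of_le_of_lt (le_max_right _ _) hψ.1
    have p1 := lt_of_le_of_lt (le_max_left _ _) hψ.1
    have hc : 0 < Real.cos ψ := Real.cos_pos_of_mem_Ioo ⟨by linarith [Real.pi_pos], hψ.2⟩
    have hs : 0 < Real.sin ψ := Real.sin_pos_of_pos_of_lt_pi p0 (by linarith [hψ.2, Real.pi_pos])
    have e : Real.tan ψ - 1 / Real.cos ψ = -(Real.cos ψ / (1 + Real.sin ψ)) := by
      rw [Real.tan_eq_sin_div_cos]
      field_simp
      linarith [Real.sin_sq_add_cos_sq ψ]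
    have := step ψ p1 p0 hψ.2
    rw [e] at this
    linarith
  have hfin : m ≤ -Real.cos (α + α₁) := by
    have hlim : Tendsto (fun θ => -Real.cos (α + θ)) (𝓝[>] α₁) (𝓝 (-Real.cos (α + α₁))) := by
      refine Tendsto.mono_left ?_ nhdsWithin_le_nhds
      exact (by fun_prop : Continuous fun θ => -Real.cos (α + θ)).continuousAt
    refine ge_of_tendsto hlim ?_
    have hmem : Ioo α₁ (min (α₁ + η) (min α (π - α))) ∈ 𝓝[>] α₁ :=
      Ioo_mem_nhdsGT (lt_min (by linarith) (lt_min hα₁.2 (by linarith)))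
    filter_upwards [hmem] with θ hθ
    obtain ⟨q1, q2⟩ := lt_min_iff.1 hθ.2
    obtain ⟨q2, q3⟩ := lt_min_iff.1 q2
    exact key θ hθ.1 q1 q2 q3
  rw [← Real.arccos_neg]
  calc Real.arccos (-m) ≤ Real.arccos (Real.cos (α + α₁)) := Real.arccos_le_arccos (by linarith)
    _ = α + α₁ := Real.arccos_cos (by linarith [hα₁.1]) hβ.le
end
end

section
/- Let 0 ≤ γ₁ ≤ γ₂ ≤ π and define γ : (0, 1] → [0, π] by γ(s) = γ₁ if s ∈ (2^{−n²}, 2^{−n(n−1)}] for some integer n ≥ 1, and γ(s) = γ₂ if s ∈ (2^{−n(n+1)}, 2^{−n²}] for some integer n ≥ 1 (these intervals partition (0, 1]). Then for every b ∈ (0, 1), limsup_{ε→0⁺} (1/ε) ∫₀^{bε} cos(γ(t)) dt = b·cos(γ₁). -/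
open Real Set Filter MeasureTheory Topology
open scoped Classical

/-- The contact angle of Example 1: `γ₁` on each interval `(2^{−n²}, 2^{−n(n−1)}]` and
`γ₂` elsewhere (in particular on each interval `(2^{−n(n+1)}, 2^{−n²}]`); these two
families of intervals partition `(0,1]`. -/
noncomputable def gammaEx1 (γ₁ γ₂ : ℝ) (s : ℝ) : ℝ :=
  if ∃ n : ℕ, 1 ≤ n ∧
      s ∈ Ioc ((2:ℝ) ^ (-((n:ℤ) ^ 2))) ((2:ℝ) ^ (-((n:ℤ) * ((n:ℤ) - 1))))
  then γ₁ else γ₂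

lemma gammaEx1_meas (γ₁ γ₂ : ℝ) : Measurable (gammaEx1 γ₁ γ₂) := by
  unfold gammaEx1
  refine Measurable.ite ?_ measurable_const measurable_const
  have : {a : ℝ | ∃ n : ℕ, 1 ≤ n ∧
      a ∈ Ioc ((2:ℝ) ^ (-((n:ℤ) ^ 2))) ((2:ℝ) ^ (-((n:ℤ) * ((n:ℤ) - 1))))}
      = ⋃ n : ℕ, ⋃ _ : 1 ≤ n,
        Ioc ((2:ℝ) ^ (-((n:ℤ) ^ 2))) ((2:ℝ) ^ (-((n:ℤ) * ((n:ℤ) - 1)))) := by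
    ext a
    simp only [mem_setOf_eq, mem_iUnion, exists_prop]
  rw [this]
  exact MeasurableSet.iUnion fun n => MeasurableSet.iUnion fun _ => measurableSet_Ioc

lemma gammaEx1_int (γ₁ γ₂ x : ℝ) :
    IntegrableOn (fun t => Real.cos (gammaEx1 γ₁ γ₂ t)) (Ioo 0 x) := by
  refine Measure.integrableOn_of_bounded (M := 1) (by simp) ?_ ?_
  · exact (Real.measurable_cos.comp (gammaEx1_meas γ₁ γ₂)).aestronglyMeasurable
  · exact Eventually.of_forall fun t => by
      rw [Real.norm_eq_abs]; exact Real.abs_cos_le_one _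

lemma gammaEx1_upper (γ₁ γ₂ : ℝ) (h₁ : 0 ≤ γ₁) (h₁₂ : γ₁ ≤ γ₂) (h₂ : γ₂ ≤ π) (x : ℝ)
    (hx : 0 < x) :
    ∫ t in Ioo (0:ℝ) x, Real.cos (gammaEx1 γ₁ γ₂ t) ≤ x * Real.cos γ₁ := by
  have h : ∫ t in Ioo (0:ℝ) x, Real.cos (gammaEx1 γ₁ γ₂ t) ≤
      ∫ t in Ioo (0:ℝ) x, Real.cos γ₁ := by
    refine setIntegral_mono (gammaEx1_int _ _ _) (integrableOn_const (by simp)) ?_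
    intro t
    dsimp only
    unfold gammaEx1
    split_ifs
    · exact le_rfl
    · exact Real.cos_le_cos_of_nonneg_of_le_pi h₁ h₂ h₁₂
  simpa [hx.le] using h

lemma gammaEx1_lower0 (γ₁ γ₂ : ℝ) (x : ℝ) (hx : 0 < x) :
    -x ≤ ∫ t in Ioo (0:ℝ) x, Real.cos (gammaEx1 γ₁ γ₂ t) := by
  have h : ∫ t in Ioo (0:ℝ) x, (-1:ℝ) ≤
      ∫ t in Ioo (0:ℝ) x, Real.cos (gammaEx1 γ₁ γ₂ t) := by
    refine setIntegral_mono (integrableOn_const (by simp)) (gammaEx1_int _ _ _) ?_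
    intro t
    exact Real.neg_one_le_cos _
  simpa [hx.le] using h

lemma gammaEx1_lower (γ₁ γ₂ : ℝ) (n : ℕ) (hn : 1 ≤ n) (x y : ℝ)
    (hx : x = (2:ℝ) ^ (-((n:ℤ) * ((n:ℤ) - 1)))) (hy : y = (2:ℝ) ^ (-((n:ℤ) ^ 2)))
    (hyx : y < x) :
    x * Real.cos γ₁ - 2 * y ≤ ∫ t in Ioo (0:ℝ) x, Real.cos (gammaEx1 γ₁ γ₂ t) := by
  have hx0 : 0 < x := by rw [hx]; positivity
  have hy0 : 0 < y := by rw [hy]; positivity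
  have hi : IntegrableOn (fun t => (Ioc 0 y).indicator (fun _ => (2:ℝ)) t) (Ioo 0 x) :=
    (integrableOn_const (by simp)).indicator measurableSet_Ioc
  have hc : IntegrableOn (fun _ => Real.cos γ₁) (Ioo 0 x) := integrableOn_const (by simp)
  have h : ∫ t in Ioo (0:ℝ) x, (Real.cos γ₁ - (Ioc 0 y).indicator (fun _ => (2:ℝ)) t) ≤
      ∫ t in Ioo (0:ℝ) x, Real.cos (gammaEx1 γ₁ γ₂ t) := by
    refine setIntegral_mono_on (hc.sub hi) (gammaEx1_int _ _ _) measurableSet_Ioo ?_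
    intro t ht
    by_cases hty : t ≤ y
    · rw [indicator_of_mem (show t ∈ Ioc 0 y from ⟨ht.1, hty⟩)]
      linarith [Real.cos_le_one γ₁, Real.neg_one_le_cos (gammaEx1 γ₁ γ₂ t)]
    · have : gammaEx1 γ₁ γ₂ t = γ₁ := by
        unfold gammaEx1
        rw [if_pos]
        exact ⟨n, hn, by rw [← hy]; exact not_le.mp hty, by rw [← hx]; exact ht.2.le⟩
      rw [this, indicator_of_notMem (fun h => hty h.2), sub_zero]
  rw [integral_sub hc hi, setIntegral_indicator measurableSet_Ioc] at h
  have he : Ioo 0 x ∩ Ioc 0 y = Ioc 0 y :=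
    inter_eq_right.mpr fun t ht => ⟨ht.1, ht.2.trans_lt hyx⟩
  rw [he] at h
  simp [hx0.le, hy0.le] at h
  linarith

/-- For the contact angle of Example 1 and any `b ∈ (0,1)`,
`limsup_{ε→0⁺} (1/ε) ∫₀^{bε} cos(γ(t)) dt = b·cos γ₁`. -/
theorem example1_limsup (γ₁ γ₂ : ℝ) (h₁ : 0 ≤ γ₁) (h₁₂ : γ₁ ≤ γ₂) (h₂ : γ₂ ≤ π)
    (b : ℝ) (hb : b ∈ Ioo (0:ℝ) 1) :
    limsup (fun ε : ℝ => ε⁻¹ * ∫ t in Ioo (0:ℝ) (b * ε), Real.cos (gammaEx1 γ₁ γ₂ t))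
        (𝓝[>] (0:ℝ)) = b * Real.cos γ₁ := by
  obtain ⟨hb0, hb1⟩ := hb
  have hup : ∀ᶠ ε : ℝ in 𝓝[>] (0:ℝ),
      ε⁻¹ * ∫ t in Ioo (0:ℝ) (b * ε), Real.cos (gammaEx1 γ₁ γ₂ t) ≤ b * Real.cos γ₁ := by
    filter_upwards [self_mem_nhdsWithin] with ε hε
    have hε : 0 < ε := hε
    rw [inv_mul_le_iff₀ hε]
    have := gammaEx1_upper γ₁ γ₂ h₁ h₁₂ h₂ (b * ε) (by positivity)
    linarith
  have hlo : ∀ᶠ ε : ℝ in 𝓝[>] (0:ℝ),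
      -b ≤ ε⁻¹ * ∫ t in Ioo (0:ℝ) (b * ε), Real.cos (gammaEx1 γ₁ γ₂ t) := by
    filter_upwards [self_mem_nhdsWithin] with ε hε
    have hε : 0 < ε := hε
    rw [le_inv_mul_iff₀ hε]
    have := gammaEx1_lower0 γ₁ γ₂ (b * ε) (by positivity)
    linarith
  have hbd := isBoundedUnder_of_eventually_le hup
  have hcb := (isBoundedUnder_of_eventually_ge hlo).isCoboundedUnder_le
  have hpow : Tendsto (fun n : ℕ => ((1/2:ℝ)) ^ n) atTop (𝓝 0) :=
    tendsto_pow_atTop_nhds_zero_of_lt_one (by norm_num) (by norm_num)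
  refine le_antisymm (limsup_le_of_le hcb hup) (le_of_forall_pos_le_add fun δ hδ => ?_)
  rw [← sub_le_iff_le_add]
  refine le_limsup_of_frequently_le ?_ hbd
  set X : ℕ → ℝ := fun n => (2:ℝ) ^ (-((n:ℤ) * ((n:ℤ) - 1))) with hX
  have hXpos : ∀ n, 0 < X n := fun n => by simp only [hX]; positivity
  have hXle : ∀ n, X n ≤ 2 * (1/2:ℝ) ^ n := by
    intro n
    have : (2:ℝ) * (1/2:ℝ) ^ n = (2:ℝ) ^ (1 - (n:ℤ)) := by
      rw [zpow_sub₀ (by norm_num), zpow_natCast]; simp [div_eq_mul_inv]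
    rw [this]
    refine zpow_le_zpow_right₀ (by norm_num) ?_
    nlinarith [sq_nonneg ((n:ℤ) - 1)]
  have hX0 : Tendsto X atTop (𝓝 0) :=
    squeeze_zero (fun n => (hXpos n).le) hXle (by simpa using hpow.const_mul 2)
  have hE : Tendsto (fun n => X n / b) atTop (𝓝[>] 0) := by
    refine tendsto_nhdsWithin_iff.mpr ⟨by simpa using hX0.div_const b, ?_⟩
    exact Eventually.of_forall fun n => div_pos (hXpos n) hb0
  refine hE.frequently (Eventually.frequently ?_)
  have hsm : ∀ᶠ n : ℕ in atTop, (1/2:ℝ) ^ n < δ / 2 :=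
    hpow.eventually (gt_mem_nhds (by positivity))
  filter_upwards [hsm, eventually_ge_atTop 1] with n hn1 hn
  have hY : (2:ℝ) ^ (-((n:ℤ) ^ 2)) = X n * (1/2:ℝ) ^ n := by
    have : ((1/2:ℝ)) ^ n = (2:ℝ) ^ (-(n:ℤ)) := by
      rw [zpow_neg, zpow_natCast]; simp
    rw [this, hX, ← zpow_add₀ (by norm_num)]
    congr 1; ring
  have hlt : (1/2:ℝ) ^ n < 1 := pow_lt_one₀ (by norm_num) (by norm_num) (by omega)
  have hXn := hXpos n
  have key := gammaEx1_lower γ₁ γ₂ n hn (X n) _ rfl rfl (by rw [hY]; nlinarith)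
  rw [hY] at key
  have hbx : b * (X n / b) = X n := by field_simp
  rw [hbx, le_inv_mul_iff₀ (by positivity)]
  refine le_trans ?_ key
  have h3 : X n / b * (b * Real.cos γ₁ - δ) = X n * Real.cos γ₁ - X n / b * δ := by
    field_simp
  rw [h3]
  have h4 : X n ≤ X n / b := by rw [le_div_iff₀ hb0]; nlinarith
  nlinarith
end
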